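/- arXiv:2405.02044 — 2 statements merged into one kernel-verified Lean document; each statement's English description precedes it below -/
import Mathlib

section
/- Assume Isaacs's condition holds. For every (τ,w) ∈ [0,T) × ℝ^n and every ε > 0 there exists δ > 0 such that for every partition Δ of [τ,T] with d(Δ) ≤ δ and every sequence u_0,…,u_m ∈ 𝒰, the trajectory x_0 = w, x_{i+1} = x_i + Δt_i f(t_i,x_i,u_i,π_v(t_i,x_i)) satisfies σ(x_{m+1}) + Σ_{i=0}^{m} Δt_i f⁰(t_i, x_i, u_i, π_v(t_i,x_i)) ≥ V(τ,w) − ε T. -/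
open scoped RealInnerProductSpace

noncomputable section

/-- `En n` is ℝ^n. -/
abbrev En (n : ℕ) : Type := EuclideanSpace ℝ (Fin n)

/-- χ(t,x,u,v,s) = ⟨f(t,x,u,v), s⟩ + f⁰(t,x,u,v). -/
def chi {n k l : ℕ} (f : ℝ → En n → En k → En l → En n)
    (f0 : ℝ → En n → En k → En l → ℝ)
    (t : ℝ) (x : En n) (u : En k) (v : En l) (s : En n) : ℝ :=
  ⟪f t x u v, s⟫ + f0 t x u v

/-- Hamiltonian H(t,x,s) = inf_{u∈𝒰} sup_{v∈𝒱} χ(t,x,u,v,s). -/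
def ham {n k l : ℕ} (U : Set (En k)) (Vs : Set (En l))
    (f : ℝ → En n → En k → En l → En n) (f0 : ℝ → En n → En k → En l → ℝ)
    (t : ℝ) (x s : En n) : ℝ :=
  ⨅ u : U, ⨆ v : Vs, chi f f0 t x u.1 v.1 s

/-- Q^Δ(t_i,x,u,v) = V(t_i,x) + Δt_i (∂_t V(t_i,x) + χ(t_i,x,u,v,∇_x V(t_i,x))) for i ≤ m,
and Q^Δ(t_{m+1},x,u,v) = σ(x). -/
def Qdelta {n k l : ℕ} (f : ℝ → En n → En k → En l → En n)
    (f0 : ℝ → En n → En k → En l → ℝ) (σ : En n → ℝ) (V : ℝ → En n → ℝ)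
    (ts : ℕ → ℝ) (m i : ℕ) (x : En n) (u : En k) (v : En l) : ℝ :=
  if i ≤ m then
    V (ts i) x + (ts (i + 1) - ts i) *
      (deriv (fun r => V r x) (ts i) +
        chi f f0 (ts i) x u v (gradient (V (ts i)) x))
  else σ x

/-- A `C¹` function has a first-order Taylor remainder that is uniformly small on a compact
convex set. -/
lemma exists_uniform_taylor_bound {E : Type*} [NormedAddCommGroup E] [NormedSpace ℝ E]
    {F : E → ℝ} (hF : ContDiff ℝ 1 F) {K : Set E} (hK : IsCompact K) (hKc : Convex ℝ K)
    {η : ℝ} (hη : 0 < η) :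
    ∃ δ > 0, ∀ p ∈ K, ∀ q ∈ K, ‖q - p‖ < δ →
      |F q - F p - fderiv ℝ F p (q - p)| ≤ η * ‖q - p‖ := by
  have hcont : Continuous (fderiv ℝ F) := hF.continuous_fderiv one_ne_zero
  obtain ⟨δ, hδ, hδK⟩ := Metric.uniformContinuousOn_iff.1
    (hK.uniformContinuousOn_of_continuous hcont.continuousOn) η hη
  refine ⟨δ, hδ, fun p hp q hq hpq => ?_⟩
  have hderiv : ∀ z ∈ segment ℝ p q, HasFDerivWithinAt F (fderiv ℝ F z) (segment ℝ p q) z :=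
    fun z _ => ((hF.differentiable one_ne_zero) z).hasFDerivAt.hasFDerivWithinAt
  have hbound : ∀ z ∈ segment ℝ p q, ‖fderiv ℝ F z - fderiv ℝ F p‖ ≤ η := by
    intro z hz
    rw [← dist_eq_norm]
    refine (hδK z (hKc.segment_subset hp hq hz) p hp ?_).le
    rw [dist_eq_norm]
    exact (norm_sub_le_of_mem_segment hz).trans_lt hpq
  exact (convex_segment p q).norm_image_sub_le_of_norm_hasFDerivWithin_le' hderiv hbound
    (left_mem_segment ℝ p q) (right_mem_segment ℝ p q)

/-- The derivative of a function of time and space in a direction `(a, a • y)`, in terms of its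
partial derivatives. -/
lemma fderiv_uncurry_apply {E : Type*} [NormedAddCommGroup E] [InnerProductSpace ℝ E]
    [CompleteSpace E] {V : ℝ → E → ℝ} {t : ℝ} {x : E}
    (hV : DifferentiableAt ℝ (Function.uncurry V) (t, x)) (a : ℝ) (y : E) :
    fderiv ℝ (Function.uncurry V) (t, x) (a, a • y) =
      a * (deriv (fun r => V r x) t + ⟪y, gradient (V t) x⟫) := by
  have htime : HasDerivAt (fun r => V r x) (fderiv ℝ (Function.uncurry V) (t, x) (1, 0)) t :=
    hV.hasFDerivAt.comp_hasDerivAt (f := fun r : ℝ => (r, x)) t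
      ((hasDerivAt_id t).prodMk (hasDerivAt_const t x))
  have hspace : HasFDerivAt (V t)
      ((fderiv ℝ (Function.uncurry V) (t, x)).comp (ContinuousLinearMap.inr ℝ ℝ E)) x :=
    hV.hasFDerivAt.comp (f := fun z : E => (t, z)) x (hasFDerivAt_prodMk_right t x)
  have hgrad : ⟪y, gradient (V t) x⟫ = fderiv ℝ (Function.uncurry V) (t, x) (0, y) := by
    rw [real_inner_comm, gradient, InnerProductSpace.toDual_symm_apply, hspace.fderiv]
    simp
  have hsplit : ((a, a • y) : ℝ × E) = a • ((1, 0) + (0, y)) := by simp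
  rw [hsplit, map_smul, map_add, htime.deriv, hgrad, smul_eq_mul]

/-- A discrete Grönwall bound on a nonuniform grid. -/
lemma one_add_le_mul_exp_of_step {c : ℝ} {m : ℕ} {ts a : ℕ → ℝ}
    (hpos : ∀ i ≤ m, 0 ≤ a i)
    (hstep : ∀ i < m, a (i + 1) ≤ a i + (ts (i + 1) - ts i) * (c * a i)) :
    ∀ i ≤ m, a i ≤ a 0 * Real.exp (c * (ts i - ts 0)) := by
  intro i
  induction i with
  | zero => simp
  | succ i ih =>
    intro hi
    have hexp : 1 + c * (ts (i + 1) - ts i) ≤ Real.exp (c * (ts (i + 1) - ts i)) := by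
      linarith [Real.add_one_le_exp (c * (ts (i + 1) - ts i))]
    calc a (i + 1) ≤ a i * (1 + c * (ts (i + 1) - ts i)) := by
          linarith [hstep i hi]
      _ ≤ a i * Real.exp (c * (ts (i + 1) - ts i)) :=
          mul_le_mul_of_nonneg_left hexp (hpos i (by omega))
      _ ≤ a 0 * Real.exp (c * (ts i - ts 0)) * Real.exp (c * (ts (i + 1) - ts i)) :=
          mul_le_mul_of_nonneg_right (ih (by omega)) (Real.exp_pos _).le
      _ = a 0 * Real.exp (c * (ts (i + 1) - ts 0)) := by
          rw [mul_assoc, ← Real.exp_add]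
          ring_nf

lemma le_of_forall_step_le {m : ℕ} {ts : ℕ → ℝ} (h : ∀ i ≤ m, ts i < ts (i + 1))
    {i j : ℕ} (hij : i ≤ j) (hj : j ≤ m + 1) : ts i ≤ ts j := by
  induction j, hij using Nat.le_induction with
  | base => exact le_rfl
  | succ j _ ih => exact (ih (by omega)).trans (h j (by omega)).le

/-- The infimum over the compact set `U` is a lower bound for `chi`. -/
lemma iInf_chi_le {n k l : ℕ} {U : Set (En k)} (hU : IsCompact U)
    {f : ℝ → En n → En k → En l → En n} {f0 : ℝ → En n → En k → En l → ℝ}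
    (hf : Continuous fun p : ℝ × En n × En k × En l => f p.1 p.2.1 p.2.2.1 p.2.2.2)
    (hf0 : Continuous fun p : ℝ × En n × En k × En l => f0 p.1 p.2.1 p.2.2.1 p.2.2.2)
    (t : ℝ) (x : En n) (v : En l) (s : En n) {u : En k} (hu : u ∈ U) :
    (⨅ u : U, chi f f0 t x u.1 v s) ≤ chi f f0 t x u v s := by
  have hpair : Continuous fun u : En k => (t, x, u, v) := by fun_prop
  have hcont : Continuous fun u : En k => chi f f0 t x u v s :=
    ((hf.comp hpair).inner continuous_const).add (hf0.comp hpair)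
  have hbdd : BddBelow (Set.range fun u : U => chi f f0 t x u.1 v s) := by
    rw [← Set.image_eq_range (fun u : En k => chi f f0 t x u v s)]
    exact hU.bddBelow_image hcont.continuousOn
  exact ciInf_le hbdd ⟨u, hu⟩

theorem stmt_7
    (n k l : ℕ) (hn : 0 < n) (hk : 0 < k) (hl : 0 < l)
    (T : ℝ) (hT : 0 < T)
    (U : Set (En k)) (Vs : Set (En l))
    (hUc : IsCompact U) (hUne : U.Nonempty) (hVc : IsCompact Vs) (hVne : Vs.Nonempty)
    (f : ℝ → En n → En k → En l → En n) (f0 : ℝ → En n → En k → En l → ℝ)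
    (hf : Continuous fun p : ℝ × En n × En k × En l => f p.1 p.2.1 p.2.2.1 p.2.2.2)
    (hf0 : Continuous fun p : ℝ × En n × En k × En l => f0 p.1 p.2.1 p.2.2.1 p.2.2.2)
    (hIsaacs : ∀ t ∈ Set.Icc (0:ℝ) T, ∀ x s : En n,
      (⨅ u : U, ⨆ v : Vs, chi f f0 t x u.1 v.1 s) =
        ⨆ v : Vs, ⨅ u : U, chi f f0 t x u.1 v.1 s)
    (σ : En n → ℝ) (hσ : Continuous σ)
    (V : ℝ → En n → ℝ) (hV : ContDiff ℝ 1 (Function.uncurry V))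
    (hHJI : ∀ t ∈ Set.Ico (0:ℝ) T, ∀ x : En n,
      deriv (fun r => V r x) t + ham U Vs f f0 t x (gradient (V t) x) = 0)
    (hVT : ∀ x : En n, V T x = σ x)
    (c_f : ℝ) (hcf : 0 < c_f)
    (hgrowth : ∀ t ∈ Set.Icc (0:ℝ) T, ∀ x : En n, ∀ u ∈ U, ∀ v ∈ Vs,
      ‖f t x u v‖ + |f0 t x u v| ≤ c_f * (1 + ‖x‖))
    (πv : ℝ → En n → En l)
    (hπmem : ∀ t ∈ Set.Icc (0:ℝ) T, ∀ x : En n, πv t x ∈ Vs)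
    (hgreedy : ∀ t ∈ Set.Icc (0:ℝ) T, ∀ x : En n,
      (⨅ u : U, chi f f0 t x u.1 (πv t x) (gradient (V t) x)) =
        ham U Vs f f0 t x (gradient (V t) x)) :
    ∀ τ : ℝ, 0 ≤ τ → τ < T → ∀ w : En n, ∀ ε : ℝ, 0 < ε →
      ∃ δ > 0, ∀ (m : ℕ) (ts : ℕ → ℝ),
        ts 0 = τ → ts (m + 1) = T → (∀ i ≤ m, ts i < ts (i + 1)) →
        (∀ i ≤ m, ts (i + 1) - ts i ≤ δ) →
        ∀ us : ℕ → En k, (∀ i ≤ m, us i ∈ U) →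
          ∀ xs : ℕ → En n, xs 0 = w →
            (∀ i ≤ m, xs (i + 1) = xs i +
              (ts (i + 1) - ts i) • f (ts i) (xs i) (us i) (πv (ts i) (xs i))) →
            σ (xs (m + 1)) +
                ∑ i ∈ Finset.range (m + 1),
                  (ts (i + 1) - ts i) * f0 (ts i) (xs i) (us i) (πv (ts i) (xs i)) ≥
              V τ w - ε * T := by
  intro τ hτ0 hτT w ε hε
  set R : ℝ := (1 + ‖w‖) * Real.exp (c_f * T) with hR
  set M : ℝ := 1 + c_f * (1 + R) with hM
  have hRpos : 0 < R := by positivity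
  have hMpos : 0 < M := by positivity
  obtain ⟨δ, hδ, hTaylor⟩ := exists_uniform_taylor_bound hV
    ((isCompact_Icc (a := (0 : ℝ)) (b := T)).prod (isCompact_closedBall (0 : En n) R))
    ((convex_Icc 0 T).prod (convex_closedBall 0 R)) (div_pos hε hMpos)
  refine ⟨δ / (2 * M), by positivity, ?_⟩
  intro m ts hts0 htsT hlt hmesh us hus xs hxs0 hxs
  have htime : ∀ i ≤ m + 1, ts i ∈ Set.Icc (0 : ℝ) T := fun i hi =>
    ⟨by linarith [le_of_forall_step_le hlt (Nat.zero_le i) hi],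
      by linarith [le_of_forall_step_le hlt hi le_rfl]⟩
  have hfx : ∀ i ≤ m, ‖f (ts i) (xs i) (us i) (πv (ts i) (xs i))‖ ≤ c_f * (1 + ‖xs i‖) := by
    intro i hi
    have hti := htime i (by omega)
    linarith [hgrowth _ hti (xs i) _ (hus i hi) _ (hπmem _ hti (xs i)),
      abs_nonneg (f0 (ts i) (xs i) (us i) (πv (ts i) (xs i)))]
  have hball : ∀ i ≤ m + 1, ‖xs i‖ ≤ R := by
    intro i hi
    have hgron := one_add_le_mul_exp_of_step (c := c_f) (m := m + 1) (ts := ts)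
      (a := fun i => 1 + ‖xs i‖) (fun i _ => by positivity) (fun i hi => by
        have hΔ : 0 ≤ ts (i + 1) - ts i := by linarith [hlt i (by omega)]
        have hnorm := norm_add_le (xs i)
          ((ts (i + 1) - ts i) • f (ts i) (xs i) (us i) (πv (ts i) (xs i)))
        rw [← hxs i (by omega), norm_smul, Real.norm_of_nonneg hΔ] at hnorm
        have := mul_le_mul_of_nonneg_left (hfx i (by omega)) hΔ
        linarith) i hi
    simp only [hxs0] at hgron
    have hexp : Real.exp (c_f * (ts i - ts 0)) ≤ Real.exp (c_f * T) := by
      apply Real.exp_le_exp.2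
      apply mul_le_mul_of_nonneg_left _ hcf.le
      linarith [(htime i hi).2]
    have := mul_le_mul_of_nonneg_left hexp (by positivity : 0 ≤ 1 + ‖w‖)
    linarith
  have hstep : ∀ i ≤ m, V (ts i) (xs i) - ε * (ts (i + 1) - ts i) ≤
      V (ts (i + 1)) (xs (i + 1)) +
        (ts (i + 1) - ts i) * f0 (ts i) (xs i) (us i) (πv (ts i) (xs i)) := by
    intro i hi
    have hΔ : 0 < ts (i + 1) - ts i := by linarith [hlt i hi]
    have hti := htime i (by omega)
    have hti' := htime (i + 1) (by omega)
    have hdiff : ((ts (i + 1), xs (i + 1)) : ℝ × En n) - (ts i, xs i) =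
        (ts (i + 1) - ts i,
          (ts (i + 1) - ts i) • f (ts i) (xs i) (us i) (πv (ts i) (xs i))) := by
      simp [hxs i hi]
    have hnorm : ‖((ts (i + 1), xs (i + 1)) : ℝ × En n) - (ts i, xs i)‖ ≤
        (ts (i + 1) - ts i) * M := by
      have hfM : ‖f (ts i) (xs i) (us i) (πv (ts i) (xs i))‖ ≤ M := by
        have := mul_le_mul_of_nonneg_left (hball i (by omega)) hcf.le
        linarith [hfx i hi]
      have hM1 : 1 ≤ M := by
        have : 0 < c_f * (1 + R) := by positivity
        linarith
      rw [hdiff, Prod.norm_def, norm_smul, Real.norm_of_nonneg hΔ.le]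
      exact max_le (le_mul_of_one_le_right hΔ.le hM1) (mul_le_mul_of_nonneg_left hfM hΔ.le)
    have hsmall : ‖((ts (i + 1), xs (i + 1)) : ℝ × En n) - (ts i, xs i)‖ < δ := by
      have := mul_le_mul_of_nonneg_right (hmesh i hi) hMpos.le
      have heq : δ / (2 * M) * M = δ / 2 := by field_simp
      linarith
    have hrem := hTaylor (ts i, xs i) ⟨hti, mem_closedBall_zero_iff.2 (hball i (by omega))⟩
      (ts (i + 1), xs (i + 1)) ⟨hti', mem_closedBall_zero_iff.2 (hball (i + 1) (by omega))⟩ hsmall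
    have hremε : ε / M * ‖((ts (i + 1), xs (i + 1)) : ℝ × En n) - (ts i, xs i)‖ ≤
        ε * (ts (i + 1) - ts i) := by
      refine (mul_le_mul_of_nonneg_left hnorm (by positivity)).trans_eq ?_
      field_simp
    have hlower := (abs_le.1 (hrem.trans hremε)).1
    rw [hdiff, fderiv_uncurry_apply (hV.differentiable one_ne_zero _)] at hlower
    simp only [Function.uncurry_apply_pair] at hlower
    have hinf := iInf_chi_le hUc hf hf0 (ts i) (xs i) (πv (ts i) (xs i))
      (gradient (V (ts i)) (xs i)) (hus i hi)
    rw [hgreedy _ hti] at hinf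
    have hpde := hHJI (ts i) ⟨hti.1, by linarith [hti'.2]⟩ (xs i)
    have hnonneg : 0 ≤ (ts (i + 1) - ts i) * (deriv (fun r => V r (xs i)) (ts i) +
        chi f f0 (ts i) (xs i) (us i) (πv (ts i) (xs i)) (gradient (V (ts i)) (xs i))) :=
      mul_nonneg hΔ.le (by linarith)
    rw [chi] at hnonneg
    linarith
  have htotal : ∀ j ≤ m + 1, V τ w - ε * (ts j - τ) ≤ V (ts j) (xs j) +
      ∑ i ∈ Finset.range j,
        (ts (i + 1) - ts i) * f0 (ts i) (xs i) (us i) (πv (ts i) (xs i)) := by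
    intro j
    induction j with
    | zero => simp [hts0, hxs0]
    | succ j ih =>
      intro hj
      rw [Finset.sum_range_succ]
      linarith [ih (by omega), hstep j (by omega)]
  have hfinal := htotal (m + 1) le_rfl
  rw [htsT, hVT] at hfinal
  linarith [mul_nonneg hε.le hτ0]
end
end

section
/- Assume Isaacs's condition holds. Then for every compact set D ⊆ ℝ^n and every ε > 0 there exists δ > 0 such that for every partition Δ of [τ,T] with d(Δ) ≤ δ, every i ∈ {0,…,m}, x ∈ D, u ∈ 𝒰_*, v ∈ 𝒱_*, setting r = Δt_i f⁰(t_i,x,u,v) and x' = x + Δt_i f(t_i,x,u,v), both |Q^Δ(t_i,x,u,v) − r − min_{u'∈𝒰_*} max_{v'∈𝒱_*} Q^Δ(t_{i+1},x',u',v')| ≤ Δt_i ε and |Q^Δ(t_i,x,u,v) − r − max_{v'∈𝒱_*} min_{u'∈𝒰_*} Q^Δ(t_{i+1},x',u',v')| ≤ Δt_i ε hold. -/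
open scoped RealInnerProductSpace

noncomputable section

open Set Filter Topology

/-- First-order Taylor expansion of a `C¹` function, uniform over a compact family of
base points and directions. -/
theorem ContDiff.exists_uniform_taylor_one {E Q : Type*} [NormedAddCommGroup E] [NormedSpace ℝ E]
    [TopologicalSpace Q] {F : E → ℝ} (hF : ContDiff ℝ 1 F) {K : Set Q} (hK : IsCompact K)
    {p w : Q → E} (hp : Continuous p) (hw : Continuous w) {ε : ℝ} (hε : 0 < ε) :
    ∃ δ > 0, ∀ h : ℝ, 0 < h → h ≤ δ → ∀ q ∈ K,
      |F (p q) + h * fderiv ℝ F (p q) (w q) - F (p q + h • w q)| ≤ h * ε := by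
  have hd : Continuous (fderiv ℝ F) := hF.continuous_fderiv (by norm_num)
  have hG : Continuous fun z : ℝ × Q =>
      |fderiv ℝ F (p z.2 + z.1 • w z.2) (w z.2) - fderiv ℝ F (p z.2) (w z.2)| := by
    refine continuous_abs.comp (Continuous.sub ?_ ?_)
    · exact (hd.comp (by fun_prop)).clm_apply (by fun_prop)
    · exact (hd.comp (by fun_prop)).clm_apply (by fun_prop)
  have hev : ∀ᶠ s in 𝓝 (0 : ℝ), ∀ q ∈ K,
      |fderiv ℝ F (p q + s • w q) (w q) - fderiv ℝ F (p q) (w q)| < ε := by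
    refine hK.eventually_forall_of_forall_eventually fun q _ => ?_
    exact hG.continuousAt.eventually_lt continuousAt_const (by simpa using hε)
  obtain ⟨δ, hδ, hball⟩ := Metric.eventually_nhds_iff.1 hev
  refine ⟨δ / 2, by positivity, fun h h0 hle q hq => ?_⟩
  have hderiv : ∀ s : ℝ, HasDerivAt (fun s : ℝ => F (p q + s • w q))
      (fderiv ℝ F (p q + s • w q) (w q)) s := fun s => by
    have h1 : HasDerivAt (fun s : ℝ => p q + s • w q) (w q) s := by
      simpa using ((hasDerivAt_id s).smul_const (w q)).const_add (p q)
    exact (hF.differentiable (by norm_num) _).hasFDerivAt.comp_hasDerivAt s h1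
  obtain ⟨c, hc, hceq⟩ := exists_hasDerivAt_eq_slope _ _ h0
    (fun s _ => (hderiv s).continuousAt.continuousWithinAt) (fun s _ => hderiv s)
  have hbd := hball (y := c) (by
    rw [Real.dist_eq, sub_zero, abs_of_pos hc.1]; linarith [hc.2]) q hq
  rw [sub_zero, eq_div_iff h0.ne', zero_smul, add_zero] at hceq
  have : F (p q) + h * fderiv ℝ F (p q) (w q) - F (p q + h • w q) =
      -(h * (fderiv ℝ F (p q + c • w q) (w q) - fderiv ℝ F (p q) (w q))) := by
    linarith
  rw [this, abs_neg, abs_mul, abs_of_pos h0]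
  exact mul_le_mul_of_nonneg_left hbd.le h0.le

theorem fderiv_uncurry_one_apply {n : ℕ} {V : ℝ → En n → ℝ} {t : ℝ} {x : En n}
    (hV : DifferentiableAt ℝ (Function.uncurry V) (t, x)) (y : En n) :
    fderiv ℝ (Function.uncurry V) (t, x) (1, y) =
      deriv (fun r => V r x) t + ⟪y, gradient (V t) x⟫ := by
  have h1 : HasDerivAt (fun r => V r x) (fderiv ℝ (Function.uncurry V) (t, x) (1, 0)) t :=
    hV.hasFDerivAt.comp_hasDerivAt (f := fun r : ℝ => (r, x)) t
      ((hasDerivAt_id t).prodMk (hasDerivAt_const t x))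
  have h2 : HasFDerivAt (V t)
      ((fderiv ℝ (Function.uncurry V) (t, x)).comp (ContinuousLinearMap.inr ℝ ℝ (En n))) x :=
    hV.hasFDerivAt.comp (f := fun z : En n => (t, z)) x (hasFDerivAt_prodMk_right t x)
  rw [h1.deriv, real_inner_comm, gradient, InnerProductSpace.toDual_symm_apply, h2.fderiv,
    ContinuousLinearMap.comp_apply, ContinuousLinearMap.inr_apply, ← map_add]
  simp

theorem ciSup_affine {ι : Type*} [Finite ι] [Nonempty ι] (a b : ℝ) {h : ℝ} (hh : 0 ≤ h)
    (c : ι → ℝ) : ⨆ i, (a + h * (b + c i)) = a + h * (b + ⨆ i, c i) := by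
  have hm : Monotone fun y : ℝ => a + h * (b + y) := fun y z hyz => by
    dsimp only; gcongr
  exact (hm.map_ciSup_of_continuousAt (by fun_prop) (finite_range c).bddAbove).symm

theorem ciInf_affine {ι : Type*} [Finite ι] [Nonempty ι] (a b : ℝ) {h : ℝ} (hh : 0 ≤ h)
    (c : ι → ℝ) : ⨅ i, (a + h * (b + c i)) = a + h * (b + ⨅ i, c i) := by
  have hm : Monotone fun y : ℝ => a + h * (b + y) := fun y z hyz => by
    dsimp only; gcongr
  exact (hm.map_ciInf_of_continuousAt (by fun_prop) (finite_range c).bddBelow).symm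

theorem le_of_forall_lt_succ {ts : ℕ → ℝ} {m : ℕ} (hlt : ∀ i ≤ m, ts i < ts (i + 1))
    {i j : ℕ} (hij : i ≤ j) (hj : j ≤ m + 1) : ts i ≤ ts j := by
  induction j, hij using Nat.le_induction with
  | base => exact le_rfl
  | succ j _ ih => exact (ih (by omega)).trans (hlt j (by omega)).le

theorem stmt_8
    (n k l : ℕ) (hn : 0 < n) (hk : 0 < k) (hl : 0 < l)
    (T : ℝ) (hT : 0 < T)
    (U : Set (En k)) (Vs : Set (En l))
    (hUc : IsCompact U) (hUne : U.Nonempty) (hVc : IsCompact Vs) (hVne : Vs.Nonempty)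
    (f : ℝ → En n → En k → En l → En n) (f0 : ℝ → En n → En k → En l → ℝ)
    (hf : Continuous fun p : ℝ × En n × En k × En l => f p.1 p.2.1 p.2.2.1 p.2.2.2)
    (hf0 : Continuous fun p : ℝ × En n × En k × En l => f0 p.1 p.2.1 p.2.2.1 p.2.2.2)
    (hIsaacs : ∀ t ∈ Set.Icc (0:ℝ) T, ∀ x s : En n,
      (⨅ u : U, ⨆ v : Vs, chi f f0 t x u.1 v.1 s) =
        ⨆ v : Vs, ⨅ u : U, chi f f0 t x u.1 v.1 s)
    (σ : En n → ℝ) (hσ : Continuous σ)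
    (V : ℝ → En n → ℝ) (hV : ContDiff ℝ 1 (Function.uncurry V))
    (hHJI : ∀ t ∈ Set.Ico (0:ℝ) T, ∀ x : En n,
      deriv (fun r => V r x) t + ham U Vs f f0 t x (gradient (V t) x) = 0)
    (hVT : ∀ x : En n, V T x = σ x)
    (Us : Set (En k)) (Vss : Set (En l))
    (hUsub : Us ⊆ U) (hVsub : Vss ⊆ Vs)
    (hUsfin : Us.Finite) (hVsfin : Vss.Finite)
    (hUsne : Us.Nonempty) (hVsne : Vss.Nonempty)
    (hUsmm : ∀ t ∈ Set.Icc (0:ℝ) T, ∀ x s : En n,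
      (⨅ u : Us, ⨆ v : Vss, chi f f0 t x u.1 v.1 s) =
        ⨅ u : U, ⨆ v : Vs, chi f f0 t x u.1 v.1 s)
    (hVsmm : ∀ t ∈ Set.Icc (0:ℝ) T, ∀ x s : En n,
      (⨆ v : Vss, ⨅ u : Us, chi f f0 t x u.1 v.1 s) =
        ⨆ v : Vs, ⨅ u : U, chi f f0 t x u.1 v.1 s)
    (τ : ℝ) (hτ0 : 0 ≤ τ) (hτT : τ < T)
    (D : Set (En n)) (hD : IsCompact D) (ε : ℝ) (hε : 0 < ε) :
    ∃ δ > 0, ∀ (m : ℕ) (ts : ℕ → ℝ),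
      ts 0 = τ → ts (m + 1) = T → (∀ i ≤ m, ts i < ts (i + 1)) →
      (∀ i ≤ m, ts (i + 1) - ts i ≤ δ) →
      ∀ i ≤ m, ∀ x ∈ D, ∀ u ∈ Us, ∀ v ∈ Vss,
        |Qdelta f f0 σ V ts m i x u v - (ts (i + 1) - ts i) * f0 (ts i) x u v -
            ⨅ u' : Us, ⨆ v' : Vss,
              Qdelta f f0 σ V ts m (i + 1)
                (x + (ts (i + 1) - ts i) • f (ts i) x u v) u'.1 v'.1| ≤
          (ts (i + 1) - ts i) * ε ∧
        |Qdelta f f0 σ V ts m i x u v - (ts (i + 1) - ts i) * f0 (ts i) x u v -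
            ⨆ v' : Vss, ⨅ u' : Us,
              Qdelta f f0 σ V ts m (i + 1)
                (x + (ts (i + 1) - ts i) • f (ts i) x u v) u'.1 v'.1| ≤
          (ts (i + 1) - ts i) * ε := by
  have : Finite Us := hUsfin
  have : Finite Vss := hVsfin
  have : Nonempty Us := hUsne.to_subtype
  have : Nonempty Vss := hVsne.to_subtype
  have hmm : ∀ t ∈ Set.Ico (0:ℝ) T, ∀ x : En n,
      deriv (fun r => V r x) t +
        (⨅ u : Us, ⨆ v : Vss, chi f f0 t x u.1 v.1 (gradient (V t) x)) = 0 := fun t ht x => by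
    rw [hUsmm t (Ico_subset_Icc_self ht)]
    exact hHJI t ht x
  have hMm : ∀ t ∈ Set.Ico (0:ℝ) T, ∀ x : En n,
      deriv (fun r => V r x) t +
        (⨆ v : Vss, ⨅ u : Us, chi f f0 t x u.1 v.1 (gradient (V t) x)) = 0 := fun t ht x => by
    rw [hVsmm t (Ico_subset_Icc_self ht), ← hIsaacs t (Ico_subset_Icc_self ht)]
    exact hHJI t ht x
  obtain ⟨δ, hδ, htaylor⟩ := hV.exists_uniform_taylor_one
    ((isCompact_Icc (a := (0:ℝ)) (b := T)).prod
      (hD.prod (hUsfin.isCompact.prod hVsfin.isCompact)))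
    (p := fun q : ℝ × En n × En k × En l => (q.1, q.2.1))
    (w := fun q => ((1 : ℝ), f q.1 q.2.1 q.2.2.1 q.2.2.2))
    (by fun_prop) (continuous_const.prodMk hf) hε
  refine ⟨δ, hδ, fun m ts h0 hT' hlt hmesh i hi x hx u hu v hv => ?_⟩
  have hmem : ∀ j ≤ m, ts j ∈ Set.Ico (0:ℝ) T := fun j hj =>
    ⟨by linarith [le_of_forall_lt_succ hlt (Nat.zero_le j) (by omega)],
      by linarith [hlt j hj, le_of_forall_lt_succ hlt (show j + 1 ≤ m + 1 by omega) le_rfl]⟩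
  have hbound := htaylor (ts (i + 1) - ts i) (sub_pos.2 (hlt i hi)) (hmesh i hi)
    (ts i, x, u, v) ⟨Ico_subset_Icc_self (hmem i hi), hx, hu, hv⟩
  rw [fderiv_uncurry_one_apply (hV.differentiable (by norm_num) _)] at hbound
  simp only [Function.uncurry_apply_pair, Prod.smul_mk, Prod.mk_add_mk, smul_eq_mul, mul_one,
    add_sub_cancel] at hbound
  set y := x + (ts (i + 1) - ts i) • f (ts i) x u v
  have hnext : (⨅ u' : Us, ⨆ v' : Vss, Qdelta f f0 σ V ts m (i + 1) y u'.1 v'.1) =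
        V (ts (i + 1)) y ∧
      (⨆ v' : Vss, ⨅ u' : Us, Qdelta f f0 σ V ts m (i + 1) y u'.1 v'.1) =
        V (ts (i + 1)) y := by
    by_cases him : i + 1 ≤ m
    · have hstep : 0 ≤ ts (i + 1 + 1) - ts (i + 1) := (sub_pos.2 (hlt _ him)).le
      simp only [Qdelta, if_pos him, ciSup_affine _ _ hstep, ciInf_affine _ _ hstep,
        hmm _ (hmem _ him), hMm _ (hmem _ him), mul_zero, add_zero, and_self]
    · obtain rfl : i = m := by omega
      simp [Qdelta, hT', hVT]
  rw [hnext.1, hnext.2, and_self]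
  convert hbound using 2
  simp only [Qdelta, if_pos hi, chi]
  ring
end
end
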